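/- arXiv:2107.00966 — 3 statements merged into one kernel-verified Lean document; each statement's English description precedes it below -/
import Mathlib

section
/- (Fundamental lemma) Suppose (A,B) is controllable, {u_k^d, y_k^d}_{k=0}^{N-1} is a trajectory of the LTI system, and u^d is persistently exciting of order L + n. Then {ū_k, ȳ_k}_{k=0}^{L-1} is a trajectory of the LTI system if and only if there exists α ∈ ℝ^{N−L+1} such that, in stacked form, H_L(u^d)α = ū and H_L(y^d)α = ȳ. -/
open Matrix

noncomputable section

/-- Hankel matrix of depth `L` of the sequence `u : {0,…,N-1} → ℝ^m`:
the block in block-row `i` and column `j` is `u (i+j)`. -/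
def Hankel (m N L : ℕ) (u : ℕ → Fin m → ℝ) :
    Matrix (Fin L × Fin m) (Fin (N - L + 1)) ℝ :=
  Matrix.of fun ik j => u ((ik.1 : ℕ) + (j : ℕ)) ik.2

/-- The sequence `u` (of length `N`) is persistently exciting of order `L`. -/
def PersistentlyExciting (m N L : ℕ) (u : ℕ → Fin m → ℝ) : Prop :=
  (Hankel m N L u).rank = m * L

/-- `{u_k, y_k}_{k=0}^{L-1}` is a trajectory of the LTI system `(A,B,C,D)`. -/
def IsTrajectory (n m p L : ℕ) (A : Matrix (Fin n) (Fin n) ℝ)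
    (B : Matrix (Fin n) (Fin m) ℝ) (C : Matrix (Fin p) (Fin n) ℝ)
    (D : Matrix (Fin p) (Fin m) ℝ) (u : ℕ → Fin m → ℝ) (y : ℕ → Fin p → ℝ) : Prop :=
  ∃ x : ℕ → Fin n → ℝ, ∀ k < L,
    x (k + 1) = A.mulVec (x k) + B.mulVec (u k) ∧
    y k = C.mulVec (x k) + D.mulVec (u k)

/-- `(A,B)` is controllable: `rank [B, AB, …, A^{n-1}B] = n`. -/
def Controllable (n m : ℕ) (A : Matrix (Fin n) (Fin n) ℝ)
    (B : Matrix (Fin n) (Fin m) ℝ) : Prop :=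
  (Matrix.of fun i (kj : Fin n × Fin m) => ((A ^ (kj.1 : ℕ)) * B) i kj.2).rank = n

/-- `(A,C)` is observable: `rank [C; CA; …; CA^{n-1}] = n`. -/
def Observable (n p : ℕ) (A : Matrix (Fin n) (Fin n) ℝ)
    (C : Matrix (Fin p) (Fin n) ℝ) : Prop :=
  (Matrix.of fun (ki : Fin n × Fin p) j => (C * A ^ (ki.1 : ℕ)) ki.2 j).rank = n

/-- A real matrix has full row rank iff its left kernel is trivial. -/
theorem rank_eq_card_rows_iff {ι κ : Type*} [Fintype ι] [Fintype κ] (M : Matrix ι κ ℝ) :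
    M.rank = Fintype.card ι ↔ ∀ v : ι → ℝ, v ᵥ* M = 0 → v = 0 := by
  rw [rank_eq_finrank_span_row, eq_comm, ← Set.finrank, ← linearIndependent_iff_card_eq_finrank_span,
    ← vecMul_injective_iff, ← coe_vecMulLinear, injective_iff_map_eq_zero]
  rfl

theorem mulVec_surjective_of_left_kernel_trivial {ι κ : Type*} [Fintype ι] [Fintype κ]
    (M : Matrix ι κ ℝ) (hM : ∀ v : ι → ℝ, v ᵥ* M = 0 → v = 0) :
    Function.Surjective M.mulVec := by
  have h : LinearMap.range M.mulVecLin = ⊤ := by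
    apply Submodule.eq_top_of_finrank_eq
    rw [Module.finrank_fintype_fun_eq_card]
    exact (rank_eq_card_rows_iff M).2 hM
  exact LinearMap.range_eq_top.1 h

theorem PersistentlyExciting.eq_zero {m N L : ℕ} {u : ℕ → Fin m → ℝ}
    (hu : PersistentlyExciting m N L u) (v : ℕ → Fin m → ℝ)
    (hv : ∀ j ≤ N - L, ∑ s ∈ Finset.range L, v s ⬝ᵥ u (j + s) = 0) :
    ∀ s < L, v s = 0 := by
  have hker := (rank_eq_card_rows_iff (Hankel m N L u)).1
    (by rw [hu, Fintype.card_prod, Fintype.card_fin, Fintype.card_fin, mul_comm])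
    (fun sa => v sa.1 sa.2) (by
      funext j
      rw [Pi.zero_apply, ← hv j (by omega), Finset.sum_range]
      simp only [vecMul, dotProduct, Hankel, of_apply, Fintype.sum_prod_type, add_comm])
  intro s hs
  funext a
  exact congrFun hker (⟨s, hs⟩, a)

theorem Controllable.eq_zero {n m : ℕ} {A : Matrix (Fin n) (Fin n) ℝ}
    {B : Matrix (Fin n) (Fin m) ℝ} (h : Controllable n m A B) (ξ : Fin n → ℝ)
    (hξ : ∀ k < n, ξ ᵥ* (A ^ k * B) = 0) : ξ = 0 := by
  refine (rank_eq_card_rows_iff _).1 (h.trans (Fintype.card_fin n).symm) ξ ?_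
  funext kj
  exact congrFun (hξ kj.1 kj.1.2) kj.2

/-- A left annihilator of the state-input data, shifted along the trajectory `k` times. -/
theorem annihilator_shift {n m N L : ℕ} {A : Matrix (Fin n) (Fin n) ℝ}
    {B : Matrix (Fin n) (Fin m) ℝ} {u : ℕ → Fin m → ℝ} {x : ℕ → Fin n → ℝ}
    (hx : ∀ k < N, x (k + 1) = A *ᵥ x k + B *ᵥ u k)
    (ξ : Fin n → ℝ) (f : ℕ → Fin m → ℝ) (hf : ∀ k, f (L + k) = ξ ᵥ* (A ^ k * B))
    (h0 : ∀ j, j + L ≤ N →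
      ξ ⬝ᵥ x j + ∑ e ∈ Finset.range L, f e ⬝ᵥ u (j + (L - 1 - e)) = 0) (k : ℕ) :
    ∀ j, j + L + k ≤ N →
      (ξ ᵥ* A ^ k) ⬝ᵥ x j
        + ∑ e ∈ Finset.range (L + k), f e ⬝ᵥ u (j + (L + k - 1 - e)) = 0 := by
  induction k with
  | zero => simpa using h0
  | succ k ih =>
    intro j hj
    rw [← ih (j + 1) (by omega), hx j (by omega), ← add_assoc L, Finset.sum_range_succ, hf,
      dotProduct_add, dotProduct_mulVec, dotProduct_mulVec, vecMul_vecMul, vecMul_vecMul, pow_succ]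
    have hsum : ∑ e ∈ Finset.range (L + k), f e ⬝ᵥ u (j + (L + k + 1 - 1 - e))
        = ∑ e ∈ Finset.range (L + k), f e ⬝ᵥ u (j + 1 + (L + k - 1 - e)) := by
      refine Finset.sum_congr rfl fun e he => ?_
      rw [Finset.mem_range] at he
      congr 2
      omega
    rw [hsum]
    simp only [Nat.add_sub_cancel, Nat.sub_self, add_zero]
    ring

/-- A sequence all of whose truncated convolutions with a monic coefficient sequence vanish
is zero. -/
theorem eq_zero_of_monic_recursion {V : Type*} [AddCommGroup V] [Module ℝ V] {n L : ℕ}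
    (c : ℕ → ℝ) (hc : c n = 1) (f : ℕ → V)
    (h : ∀ s < L + n,
      ∑ k ∈ Finset.range (n + 1), c k • (if s < L + k then f (L + k - 1 - s) else 0) = 0) :
    ∀ d < L + n, f d = 0 := by
  intro d
  induction d using Nat.strong_induction_on with
  | _ d ih =>
    intro hd
    have hs := h (L + n - 1 - d) (by omega)
    rw [Finset.sum_range_succ, Finset.sum_eq_zero, hc, one_smul, zero_add,
      if_pos (by omega)] at hs
    · rwa [show L + n - 1 - (L + n - 1 - d) = d by omega] at hs
    · intro k hk
      rw [Finset.mem_range] at hk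
      split_ifs
      · rw [ih _ (by omega) (by omega), smul_zero]
      · rw [smul_zero]

/-- Under controllability and persistence of excitation of order `L + n`, the matrix stacking
the states and the input Hankel matrix of depth `L` has trivial left kernel. -/
theorem state_input_left_kernel_trivial {n m N L : ℕ} {A : Matrix (Fin n) (Fin n) ℝ}
    {B : Matrix (Fin n) (Fin m) ℝ} (hctrb : Controllable n m A B)
    {u : ℕ → Fin m → ℝ} {x : ℕ → Fin n → ℝ}
    (hx : ∀ k < N, x (k + 1) = A *ᵥ x k + B *ᵥ u k) (hLN : L + n ≤ N)
    (hPE : PersistentlyExciting m N (L + n) u) (ξ : Fin n → ℝ) (η : ℕ → Fin m → ℝ)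
    (h : ∀ j, j + L ≤ N → ξ ⬝ᵥ x j + ∑ i ∈ Finset.range L, η i ⬝ᵥ u (j + i) = 0) :
    ξ = 0 ∧ ∀ i < L, η i = 0 := by
  set f : ℕ → Fin m → ℝ := fun e => if e < L then η (L - 1 - e) else ξ ᵥ* (A ^ (e - L) * B)
    with hfdef
  have hf : ∀ k, f (L + k) = ξ ᵥ* (A ^ k * B) := fun k => by simp [hfdef]
  have hfη : ∀ i < L, f (L - 1 - i) = η i := fun i hi => by
    rw [hfdef]
    simp only
    rw [if_pos (by omega), show L - 1 - (L - 1 - i) = i by omega]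
  have hshift := annihilator_shift hx ξ f hf (fun j hj => by
    rw [← h j hj, ← Finset.sum_range_reflect (fun i => η i ⬝ᵥ u (j + i))]
    congr 1
    refine Finset.sum_congr rfl fun e he => ?_
    rw [hfdef]
    simp only
    rw [if_pos (Finset.mem_range.1 he)])
  have hCH : ∑ k ∈ Finset.range (n + 1), A.charpoly.coeff k • A ^ k = 0 := by
    have := A.aeval_self_charpoly
    rwa [Polynomial.aeval_eq_sum_range, charpoly_natDegree_eq_dim, Fintype.card_fin] at this
  have hmonic : A.charpoly.coeff n = 1 := by
    have := A.charpoly_monic.coeff_natDegree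
    rwa [charpoly_natDegree_eq_dim, Fintype.card_fin] at this
  have hzero : ∀ d < L + n, f d = 0 := by
    refine eq_zero_of_monic_recursion A.charpoly.coeff hmonic f (hPE.eq_zero _ fun j hj => ?_)
    have hk : ∀ k ∈ Finset.range (n + 1),
        ∑ s ∈ Finset.range (L + n), (if s < L + k then f (L + k - 1 - s) else 0) ⬝ᵥ u (j + s)
          = -((ξ ᵥ* A ^ k) ⬝ᵥ x j) := by
      intro k hk
      rw [Finset.mem_range] at hk
      rw [eq_neg_iff_add_eq_zero, add_comm, ← hshift k j (by omega),
        ← Finset.sum_range_reflect (fun e => f e ⬝ᵥ u (j + (L + k - 1 - e)))]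
      congr 1
      rw [← Finset.sum_subset (Finset.range_subset_range.2 (show L + k ≤ L + n by omega))]
      · refine Finset.sum_congr rfl fun s hs => ?_
        rw [Finset.mem_range] at hs
        rw [if_pos hs, show L + k - 1 - (L + k - 1 - s) = s by omega]
      · intro s _ hs
        rw [if_neg (by simpa using hs), zero_dotProduct]
    simp only [sum_dotProduct, smul_dotProduct]
    rw [Finset.sum_comm]
    simp only [← Finset.smul_sum]
    rw [Finset.sum_congr rfl fun k hk' => by rw [hk k hk']]
    have h0 : (ξ ᵥ* ∑ k ∈ Finset.range (n + 1), A.charpoly.coeff k • A ^ k) ⬝ᵥ x j = 0 := by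
      rw [hCH, vecMul_zero, zero_dotProduct]
    simpa [vecMul_sum, vecMul_smul, sum_dotProduct, smul_dotProduct] using h0
  refine ⟨hctrb.eq_zero ξ fun k hk => ?_, fun i hi => ?_⟩
  · rw [← hf, hzero _ (by omega)]
  · rw [← hfη i hi, hzero _ (by omega)]

theorem Hankel_mulVec_apply {m N L : ℕ} (u : ℕ → Fin m → ℝ) (α : Fin (N - L + 1) → ℝ)
    (k : Fin L) (a : Fin m) :
    (Hankel m N L u *ᵥ α) (k, a) = (∑ j, α j • u (k + j)) a := by
  simp [Hankel, mulVec, dotProduct, mul_comm]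

/-- Linear combinations of time-shifts of a signal satisfying a pointwise linear relation
satisfy the same relation. -/
theorem sum_smul_of_linear_relation {κ q n m : Type*} [Fintype κ] [Fintype n] [Fintype m]
    (α : κ → ℝ) (E : Matrix q n ℝ) (F : Matrix q m ℝ)
    {z : κ → q → ℝ} {x : κ → n → ℝ} {u : κ → m → ℝ}
    (h : ∀ j, z j = E *ᵥ x j + F *ᵥ u j) :
    ∑ j, α j • z j = E *ᵥ (∑ j, α j • x j) + F *ᵥ (∑ j, α j • u j) := by
  simp only [h, mulVec_sum, mulVec_smul, smul_add, Finset.sum_add_distrib]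

/-- Under controllability and persistence of excitation, every initial state and every input
sequence of length `L` is realised by a common combination of the data columns. -/
theorem exists_state_input_combination {n m N L : ℕ} {A : Matrix (Fin n) (Fin n) ℝ}
    {B : Matrix (Fin n) (Fin m) ℝ} (hctrb : Controllable n m A B)
    {u : ℕ → Fin m → ℝ} {x : ℕ → Fin n → ℝ}
    (hx : ∀ k < N, x (k + 1) = A *ᵥ x k + B *ᵥ u k) (hLN : L + n ≤ N)
    (hPE : PersistentlyExciting m N (L + n) u) (x₀ : Fin n → ℝ) (v : ℕ → Fin m → ℝ) :
    ∃ α : Fin (N - L + 1) → ℝ, ∑ j, α j • x j = x₀ ∧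
      ∀ (k : Fin L), ∑ j, α j • u (k + j) = v k := by
  let M : Matrix (Fin n ⊕ Fin L × Fin m) (Fin (N - L + 1)) ℝ :=
    fromRows (of fun i j => x j i) (Hankel m N L u)
  have hM : ∀ w, w ᵥ* M = 0 → w = 0 := by
    intro w hw
    obtain ⟨hξ, hη⟩ := state_input_left_kernel_trivial hctrb hx hLN hPE (fun i => w (.inl i))
      (fun i a => if h : i < L then w (.inr (⟨i, h⟩, a)) else 0) (fun j hj => by
        have hj' := congrFun hw ⟨j, by omega⟩
        rw [Pi.zero_apply] at hj'
        rw [← hj', Finset.sum_range]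
        simp [M, vecMul, dotProduct, Fintype.sum_sum_type, Fintype.sum_prod_type, Hankel,
          add_comm])
    funext r
    rcases r with i | ⟨i, a⟩
    · exact congrFun hξ i
    · simpa using congrFun (hη i i.2) a
  obtain ⟨α, hα⟩ := mulVec_surjective_of_left_kernel_trivial M hM
    (Sum.elim x₀ fun ka => v ka.1 ka.2)
  refine ⟨α, ?_, fun k => ?_⟩
  · funext i
    have := congrFun hα (.inl i)
    simpa [M, mulVec, dotProduct, mul_comm] using this
  · funext a
    rw [← Hankel_mulVec_apply]
    simpa [M] using congrFun hα (.inr (k, a))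

/-- Fundamental lemma: under controllability and persistence of excitation of order
`L + n`, `(ū, ȳ)` is a trajectory of the system iff it is a linear combination of the
columns of the stacked Hankel matrices of the measured data. -/
theorem fundamental_lemma (n m p N L : ℕ)
    (A : Matrix (Fin n) (Fin n) ℝ) (B : Matrix (Fin n) (Fin m) ℝ)
    (C : Matrix (Fin p) (Fin n) ℝ) (D : Matrix (Fin p) (Fin m) ℝ)
    (hctrb : Controllable n m A B)
    (ud : ℕ → Fin m → ℝ) (yd : ℕ → Fin p → ℝ)
    (hT : IsTrajectory n m p N A B C D ud yd)
    (hL1 : 1 ≤ L) (hLN : L + n ≤ N)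
    (hPE : PersistentlyExciting m N (L + n) ud) :
    ∀ (ub : ℕ → Fin m → ℝ) (yb : ℕ → Fin p → ℝ),
      IsTrajectory n m p L A B C D ub yb ↔
      ∃ α : Fin (N - L + 1) → ℝ,
        (∀ (k : Fin L) (a : Fin m), (Hankel m N L ud).mulVec α (k, a) = ub k a) ∧
        (∀ (k : Fin L) (b : Fin p), (Hankel p N L yd).mulVec α (k, b) = yb k b) := by
  intro ub yb
  obtain ⟨x, hx⟩ := hT
  have hstate (α : Fin (N - L + 1) → ℝ) (k : ℕ) (hk : k < L) :
      ∑ j, α j • x (k + 1 + j)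
        = A *ᵥ (∑ j, α j • x (k + j)) + B *ᵥ (∑ j, α j • ud (k + j)) :=
    sum_smul_of_linear_relation α A B fun j => by
      rw [add_right_comm]
      exact (hx _ (by omega)).1
  have hout (α : Fin (N - L + 1) → ℝ) (k : ℕ) (hk : k < L) :
      ∑ j, α j • yd (k + j)
        = C *ᵥ (∑ j, α j • x (k + j)) + D *ᵥ (∑ j, α j • ud (k + j)) :=
    sum_smul_of_linear_relation α C D fun j => (hx _ (by omega)).2
  simp only [Hankel_mulVec_apply, ← funext_iff]
  constructor
  · rintro ⟨z, hz⟩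
    obtain ⟨α, hα0, hαu⟩ :=
      exists_state_input_combination hctrb (fun k hk => (hx k hk).1) hLN hPE (z 0) ub
    have hxz : ∀ k ≤ L, ∑ j, α j • x (k + j) = z k := by
      intro k
      induction k with
      | zero => simpa using hα0
      | succ k ih =>
        intro hk
        rw [hstate α k hk, ih (by omega), hαu ⟨k, hk⟩, (hz k hk).1]
    refine ⟨α, funext hαu, funext fun k => ?_⟩
    rw [hout α k k.2, hxz k k.2.le, hαu k, (hz k k.2).2]
  · rintro ⟨α, hu, hy⟩
    refine ⟨fun k => ∑ j, α j • x (k + j), fun k hk => ?_⟩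
    rw [← congrFun hu ⟨k, hk⟩, ← congrFun hy ⟨k, hk⟩]
    exact ⟨hstate α k hk, hout α k hk⟩
end
end

section
/- Suppose (A,B) is controllable, (A,C) is observable, L ≥ n, {u_k^d, y_k^d}_{k=0}^{N-1} is a trajectory of the LTI system, and u^d is persistently exciting of order L + n. Then the stacked Hankel matrix [H_L(u^d); H_L(y^d)] has rank mL + n, and its column space equals the set of all (stacked) input-output trajectories of length L of the LTI system. -/
open Matrix

noncomputable section

/-- The stacked Hankel matrix `[H_L(u); H_L(y)]`. -/
def stackedHankel (m p N L : ℕ) (u : ℕ → Fin m → ℝ) (y : ℕ → Fin p → ℝ) :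
    Matrix ((Fin L × Fin m) ⊕ (Fin L × Fin p)) (Fin (N - L + 1)) ℝ :=
  Matrix.of fun i j =>
    match i with
    | Sum.inl ka => u ((ka.1 : ℕ) + (j : ℕ)) ka.2
    | Sum.inr kb => y ((kb.1 : ℕ) + (j : ℕ)) kb.2

section Rank

theorem rank_eq_rank_of_ker_iff {ι ι' κ : Type*} [Fintype κ] {M : Matrix ι κ ℝ}
    {M' : Matrix ι' κ ℝ} (h : ∀ v, M *ᵥ v = 0 ↔ M' *ᵥ v = 0) : M.rank = M'.rank := by
  have hker : LinearMap.ker M.mulVecLin = LinearMap.ker M'.mulVecLin := by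
    ext v
    simpa using h v
  have h₁ := LinearMap.finrank_range_add_finrank_ker M.mulVecLin
  have h₂ := LinearMap.finrank_range_add_finrank_ker M'.mulVecLin
  rw [hker] at h₁
  unfold Matrix.rank
  omega

variable {ι κ : Type*} [Fintype ι] [Fintype κ]

theorem eq_zero_of_vecMul_eq_zero_of_rank {M : Matrix ι κ ℝ} (hM : M.rank = Fintype.card ι)
    {v : ι → ℝ} (hv : v ᵥ* M = 0) : v = 0 := by
  have hli : LinearIndependent ℝ M.row := by
    rw [linearIndependent_iff_card_eq_finrank_span, ← hM, Matrix.rank_eq_finrank_span_row]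
    rfl
  exact Matrix.vecMul_injective_iff.2 hli (by simpa using hv)

theorem eq_zero_of_mulVec_eq_zero_of_rank {M : Matrix ι κ ℝ} (hM : M.rank = Fintype.card κ)
    {v : κ → ℝ} (hv : M *ᵥ v = 0) : v = 0 :=
  eq_zero_of_vecMul_eq_zero_of_rank (M := Mᵀ) (by rw [Matrix.rank_transpose, hM])
    (by rw [Matrix.vecMul_transpose, hv])

theorem rank_eq_card_of_vecMul_eq_zero {M : Matrix ι κ ℝ}
    (hM : ∀ v : ι → ℝ, v ᵥ* M = 0 → v = 0) : M.rank = Fintype.card ι := by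
  refine LinearIndependent.rank_matrix (Matrix.vecMul_injective_iff.1 fun v w hvw => ?_)
  exact sub_eq_zero.1 (hM _ (by rw [Matrix.sub_vecMul]; exact sub_eq_zero.2 hvw))

theorem mulVec_surjective_of_rank {M : Matrix ι κ ℝ} (hM : M.rank = Fintype.card ι) :
    Function.Surjective M.mulVec := by
  have htop : LinearMap.range M.mulVecLin = ⊤ :=
    Submodule.eq_top_of_finrank_eq (by rw [Module.finrank_fintype_fun_eq_card]; exact hM)
  exact LinearMap.range_eq_top.1 htop

end Rank

section Systems

variable {n m p : ℕ} {A : Matrix (Fin n) (Fin n) ℝ} {B : Matrix (Fin n) (Fin m) ℝ}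
  {C : Matrix (Fin p) (Fin n) ℝ}

theorem PersistentlyExciting.eq_zero_of_sum_dotProduct_eq_zero {N M : ℕ}
    {u : ℕ → Fin m → ℝ} (hu : PersistentlyExciting m N M u) {c : ℕ → Fin m → ℝ}
    (hc : ∀ j ≤ N - M, ∑ t ∈ Finset.range M, c t ⬝ᵥ u (j + t) = 0) {t : ℕ} (ht : t < M) :
    c t = 0 := by
  have h := eq_zero_of_vecMul_eq_zero_of_rank (M := Hankel m N M u)
    (v := fun ta => c ta.1 ta.2) (by rw [hu]; simp [mul_comm]) (by
      ext j
      rw [Pi.zero_apply, ← hc j (by omega), Finset.sum_range]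
      simp [Matrix.vecMul, dotProduct, Hankel, Fintype.sum_prod_type, add_comm])
  ext a
  exact congrFun h (⟨t, ht⟩, a)

theorem Controllable.eq_zero_of_vecMul_eq_zero (h : Controllable n m A B) {ξ : Fin n → ℝ}
    (hξ : ∀ i < n, ξ ᵥ* (A ^ i * B) = 0) : ξ = 0 := by
  refine eq_zero_of_vecMul_eq_zero_of_rank (h.trans (by simp)) ?_
  ext ia
  exact congrFun (hξ ia.1 ia.1.2) ia.2

theorem Observable.eq_zero_of_mulVec_eq_zero (h : Observable n p A C) {x : Fin n → ℝ}
    (hx : ∀ i < n, (C * A ^ i) *ᵥ x = 0) : x = 0 := by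
  refine eq_zero_of_mulVec_eq_zero_of_rank (h.trans (by simp)) ?_
  ext ib
  exact congrFun (hx ib.1 ib.1.2) ib.2

theorem state_add_eq {x : ℕ → Fin n → ℝ} {u : ℕ → Fin m → ℝ} (k : ℕ) : ∀ j : ℕ,
    (∀ i < j + k, x (i + 1) = A *ᵥ x i + B *ᵥ u i) →
    x (j + k) = A ^ k *ᵥ x j + ∑ t ∈ Finset.range k, (A ^ (k - 1 - t) * B) *ᵥ u (j + t) := by
  induction k with
  | zero => simp
  | succ k ih =>
    intro j hx
    have h := ih (j + 1) fun i hi => hx i (by omega)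
    rw [show j + (k + 1) = j + 1 + k by ring, h, hx j (by omega), Finset.sum_range_succ',
      Matrix.mulVec_add, Matrix.mulVec_mulVec, Matrix.mulVec_mulVec, ← pow_succ]
    have hs : ∀ t, k - 1 - t = k - (t + 1) := by omega
    have hj : ∀ t, j + 1 + t = j + (t + 1) := by omega
    simp only [hs, hj, add_zero, Nat.add_sub_cancel, Nat.sub_zero]
    abel

/-- The annihilator of the input window obtained from the annihilator `(ξ, η)` of the state and
the input window after a shift by `k` steps. -/
def shiftedAnnihilator (A : Matrix (Fin n) (Fin n) ℝ) (B : Matrix (Fin n) (Fin m) ℝ)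
    (ξ : Fin n → ℝ) (η : ℕ → Fin m → ℝ) (k t : ℕ) : Fin m → ℝ :=
  if t < k then ξ ᵥ* (A ^ (k - 1 - t) * B) else η (t - k)

theorem dotProduct_add_sum_shiftedAnnihilator {L : ℕ} {x : ℕ → Fin n → ℝ} {u : ℕ → Fin m → ℝ}
    {ξ : Fin n → ℝ} {η : ℕ → Fin m → ℝ} (hη : ∀ t, L ≤ t → η t = 0) {j k : ℕ} (hk : k ≤ n)
    (hx : ∀ i < j + k, x (i + 1) = A *ᵥ x i + B *ᵥ u i) :
    ξ ⬝ᵥ (A ^ k *ᵥ x j) +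
        ∑ t ∈ Finset.range (L + n), shiftedAnnihilator A B ξ η k t ⬝ᵥ u (j + t) =
      ξ ⬝ᵥ x (j + k) + ∑ t ∈ Finset.range L, η t ⬝ᵥ u (j + k + t) := by
  have htail : ∑ t ∈ Finset.range (L + (n - k)), η t ⬝ᵥ u (j + k + t) =
      ∑ t ∈ Finset.range L, η t ⬝ᵥ u (j + k + t) := by
    rw [Finset.sum_range_add, add_eq_left]
    exact Finset.sum_eq_zero fun t _ => by rw [hη _ (by omega), zero_dotProduct]
  have hhead : ∑ t ∈ Finset.range k, shiftedAnnihilator A B ξ η k t ⬝ᵥ u (j + t) =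
      ∑ t ∈ Finset.range k, ξ ⬝ᵥ ((A ^ (k - 1 - t) * B) *ᵥ u (j + t)) :=
    Finset.sum_congr rfl fun t ht => by
      rw [shiftedAnnihilator, if_pos (Finset.mem_range.1 ht), Matrix.dotProduct_mulVec]
  rw [show L + n = k + (L + (n - k)) by omega, Finset.sum_range_add, hhead, ← htail,
    state_add_eq k j hx, dotProduct_add, dotProduct_sum, add_assoc]
  simp [shiftedAnnihilator, add_assoc]

/-- Under controllability and persistence of excitation of order `L + n`, no nonzero linear
functional annihilates all windows consisting of a state and the next `L` inputs. -/
theorem PersistentlyExciting.annihilator_eq_zero {N L : ℕ} {x : ℕ → Fin n → ℝ}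
    {u : ℕ → Fin m → ℝ} (hu : PersistentlyExciting m N (L + n) u) (hLN : L + n ≤ N)
    (hctrb : Controllable n m A B) (hx : ∀ k < N, x (k + 1) = A *ᵥ x k + B *ᵥ u k)
    {ξ : Fin n → ℝ} {η : ℕ → Fin m → ℝ} (hη : ∀ t, L ≤ t → η t = 0)
    (h : ∀ j ≤ N - L, ξ ⬝ᵥ x j + ∑ t ∈ Finset.range L, η t ⬝ᵥ u (j + t) = 0) :
    ξ = 0 ∧ ∀ t, η t = 0 := by
  set a : ℕ → ℝ := A.charpoly.coeff
  have hdeg : A.charpoly.natDegree = n := by simp [Matrix.charpoly_natDegree_eq_dim]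
  have han : a n = 1 := by
    have := A.charpoly_monic.coeff_natDegree
    rwa [hdeg] at this
  have hCH : ∑ k ∈ Finset.range (n + 1), a k • A ^ k = 0 := by
    rw [← A.aeval_self_charpoly, Polynomial.aeval_eq_sum_range, hdeg]
  have hcoeff : ∀ t < L + n,
      ∑ k ∈ Finset.range (n + 1), a k • shiftedAnnihilator A B ξ η k t = 0 := fun t ht => by
    refine hu.eq_zero_of_sum_dotProduct_eq_zero
      (c := fun t => ∑ k ∈ Finset.range (n + 1), a k • shiftedAnnihilator A B ξ η k t)
      (fun j hj => ?_) ht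
    have hstate : ∑ k ∈ Finset.range (n + 1), a k * (ξ ⬝ᵥ (A ^ k *ᵥ x j)) = 0 := by
      have := congrArg (fun M => ξ ⬝ᵥ (M *ᵥ x j)) hCH
      simpa [Matrix.sum_mulVec, dotProduct_sum, Matrix.smul_mulVec] using this
    simp only [sum_dotProduct, smul_dotProduct, smul_eq_mul]
    rw [Finset.sum_comm]
    refine add_eq_left.1 (Eq.trans ?_ hstate.symm)
    rw [← Finset.sum_add_distrib]
    refine Finset.sum_eq_zero fun k hk => ?_
    have hk : k ≤ n := by simpa [Nat.lt_succ_iff] using hk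
    rw [← Finset.mul_sum, ← mul_add,
      dotProduct_add_sum_shiftedAnnihilator hη hk fun i hi => hx i (by omega),
      h _ (by omega), mul_zero]
  have hη0 : ∀ s t, L ≤ t + s → η t = 0 := by
    intro s
    induction s with
    | zero => exact fun t ht => hη t ht
    | succ s ih =>
      intro t ht
      by_cases htL : L ≤ t
      · exact hη t htL
      have := hcoeff (t + n) (by omega)
      rw [Finset.sum_range_succ, Finset.sum_eq_zero, zero_add, han, one_smul,
        shiftedAnnihilator, if_neg (by omega), Nat.add_sub_cancel] at this
      · exact this
      · intro k hk
        have hk := Finset.mem_range.1 hk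
        rw [shiftedAnnihilator, if_neg (by omega), ih _ (by omega), smul_zero]
  have hη0 : ∀ t, η t = 0 := fun t => hη0 L t (by omega)
  refine ⟨hctrb.eq_zero_of_vecMul_eq_zero fun i => ?_, hη0⟩
  induction i using Nat.strong_induction_on with
  | _ i ih =>
    intro hi
    have := hcoeff (n - 1 - i) (by omega)
    rw [Finset.sum_range_succ, Finset.sum_eq_zero, zero_add, han, one_smul,
      shiftedAnnihilator, if_pos (by omega), show n - 1 - (n - 1 - i) = i by omega] at this
    · exact this
    · intro k hk
      have hk := Finset.mem_range.1 hk
      rw [shiftedAnnihilator]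
      split_ifs
      · rw [ih _ (by omega) (by omega), smul_zero]
      · rw [hη0, smul_zero]

/-- The matrix whose columns are the windows consisting of a state and the next `L` inputs. -/
def stateInputHankel (N L : ℕ) (x : ℕ → Fin n → ℝ) (u : ℕ → Fin m → ℝ) :
    Matrix (Fin n ⊕ Fin L × Fin m) (Fin (N - L + 1)) ℝ :=
  Matrix.fromRows (Matrix.of fun i j => x j i) (Hankel m N L u)

theorem PersistentlyExciting.rank_stateInputHankel {N L : ℕ} {x : ℕ → Fin n → ℝ}
    {u : ℕ → Fin m → ℝ} (hu : PersistentlyExciting m N (L + n) u) (hLN : L + n ≤ N)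
    (hctrb : Controllable n m A B) (hx : ∀ k < N, x (k + 1) = A *ᵥ x k + B *ᵥ u k) :
    (stateInputHankel N L x u).rank = Fintype.card (Fin n ⊕ Fin L × Fin m) := by
  refine rank_eq_card_of_vecMul_eq_zero fun v hv => ?_
  let η : ℕ → Fin m → ℝ := fun t a => if ht : t < L then v (Sum.inr (⟨t, ht⟩, a)) else 0
  obtain ⟨hξ, hη⟩ := hu.annihilator_eq_zero hLN hctrb hx (ξ := v ∘ Sum.inl) (η := η)
    (fun t ht => by ext a; simp [η, ht.not_gt]) (fun j hj => by
      have := congrFun hv ⟨j, by omega⟩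
      rw [Finset.sum_range]
      simpa [stateInputHankel, Matrix.vecMul, dotProduct, Hankel, Fintype.sum_prod_type, η,
        add_comm] using this)
  ext (i | ⟨t, a⟩)
  · exact congrFun hξ i
  · simpa [η] using congrFun (hη t) a

theorem state_eq_of_initial_eq {L : ℕ} {x x' : ℕ → Fin n → ℝ} {u u' : ℕ → Fin m → ℝ}
    (hx : ∀ k < L, x (k + 1) = A *ᵥ x k + B *ᵥ u k)
    (hx' : ∀ k < L, x' (k + 1) = A *ᵥ x' k + B *ᵥ u' k)
    (h0 : x 0 = x' 0) (hu : ∀ k < L, u k = u' k) : ∀ k ≤ L, x k = x' k := by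
  intro k
  induction k with
  | zero => exact fun _ => h0
  | succ k ih => exact fun hk => by rw [hx k hk, hx' k hk, ih (by omega), hu k hk]

theorem Observable.initial_eq_zero {L : ℕ} (hobs : Observable n p A C) (hL : n ≤ L)
    {x : ℕ → Fin n → ℝ} (hx : ∀ k < L, x (k + 1) = A *ᵥ x k) (hy : ∀ k < L, C *ᵥ x k = 0) :
    x 0 = 0 := by
  have hpow : ∀ k ≤ L, x k = A ^ k *ᵥ x 0 := by
    intro k
    induction k with
    | zero => simp
    | succ k ih => exact fun hk => by rw [hx k hk, ih (by omega), Matrix.mulVec_mulVec, pow_succ']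
  refine hobs.eq_zero_of_mulVec_eq_zero fun i hi => ?_
  rw [← Matrix.mulVec_mulVec, ← hpow i (by omega), hy i (by omega)]

/-- The linear combination with weights `α` of the shifts `w (0 + ·), w (1 + ·), …` of `w`. -/
def combineShifts {ι : Type*} {K : ℕ} (w : ℕ → ι → ℝ) (α : Fin K → ℝ) (k : ℕ) : ι → ℝ :=
  ∑ j, α j • w (k + j)

theorem mulVec_combineShifts {ι κ : Type*} [Fintype κ] {K : ℕ} (M : Matrix ι κ ℝ)
    (w : ℕ → κ → ℝ) (α : Fin K → ℝ) (k : ℕ) :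
    M *ᵥ combineShifts w α k = ∑ j, α j • (M *ᵥ w (k + j)) := by
  simp [combineShifts, Matrix.mulVec_sum, Matrix.mulVec_smul]

theorem combineShifts_eq_mulVec_add_mulVec {ι κ κ' : Type*} [Fintype κ] [Fintype κ'] {K : ℕ}
    {z : ℕ → ι → ℝ} {w : ℕ → κ → ℝ} {w' : ℕ → κ' → ℝ} {M : Matrix ι κ ℝ} {M' : Matrix ι κ' ℝ}
    {k l : ℕ} (h : ∀ j < K, z (l + j) = M *ᵥ w (k + j) + M' *ᵥ w' (k + j)) (α : Fin K → ℝ) :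
    combineShifts z α l = M *ᵥ combineShifts w α k + M' *ᵥ combineShifts w' α k := by
  rw [mulVec_combineShifts, mulVec_combineShifts, ← Finset.sum_add_distrib]
  exact Finset.sum_congr rfl fun j _ => by rw [h j j.2, smul_add]

theorem stackedHankel_mulVec_inl {N L : ℕ} (u : ℕ → Fin m → ℝ) (y : ℕ → Fin p → ℝ)
    (α : Fin (N - L + 1) → ℝ) (k : Fin L) (a : Fin m) :
    (stackedHankel m p N L u y *ᵥ α) (Sum.inl (k, a)) = combineShifts u α k a := by
  simp [stackedHankel, combineShifts, Matrix.mulVec, dotProduct, mul_comm]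

theorem stackedHankel_mulVec_inr {N L : ℕ} (u : ℕ → Fin m → ℝ) (y : ℕ → Fin p → ℝ)
    (α : Fin (N - L + 1) → ℝ) (k : Fin L) (b : Fin p) :
    (stackedHankel m p N L u y *ᵥ α) (Sum.inr (k, b)) = combineShifts y α k b := by
  simp [stackedHankel, combineShifts, Matrix.mulVec, dotProduct, mul_comm]

theorem stateInputHankel_mulVec_inl {N L : ℕ} (x : ℕ → Fin n → ℝ) (u : ℕ → Fin m → ℝ)
    (α : Fin (N - L + 1) → ℝ) (i : Fin n) :
    (stateInputHankel N L x u *ᵥ α) (Sum.inl i) = combineShifts x α 0 i := by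
  simp [stateInputHankel, combineShifts, Matrix.mulVec, dotProduct, mul_comm]

theorem stateInputHankel_mulVec_inr {N L : ℕ} (x : ℕ → Fin n → ℝ) (u : ℕ → Fin m → ℝ)
    (α : Fin (N - L + 1) → ℝ) (k : Fin L) (a : Fin m) :
    (stateInputHankel N L x u *ᵥ α) (Sum.inr (k, a)) = combineShifts u α k a := by
  simp [stateInputHankel, Hankel, combineShifts, Matrix.mulVec, dotProduct, mul_comm]

end Systems

/-- Under controllability, observability, `L ≥ n`, and persistence of excitation of
order `L + n`, the stacked Hankel matrix `[H_L(u^d); H_L(y^d)]` has rank `mL + n` and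
its column space equals the set of stacked input-output trajectories of length `L`. -/
theorem stacked_hankel_rank_and_image (n m p N L : ℕ)
    (A : Matrix (Fin n) (Fin n) ℝ) (B : Matrix (Fin n) (Fin m) ℝ)
    (C : Matrix (Fin p) (Fin n) ℝ) (D : Matrix (Fin p) (Fin m) ℝ)
    (hctrb : Controllable n m A B) (hobs : Observable n p A C)
    (hL : n ≤ L) (hL1 : 1 ≤ L) (hLN : L + n ≤ N)
    (ud : ℕ → Fin m → ℝ) (yd : ℕ → Fin p → ℝ)
    (hT : IsTrajectory n m p N A B C D ud yd)
    (hPE : PersistentlyExciting m N (L + n) ud) :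
    (stackedHankel m p N L ud yd).rank = m * L + n ∧
    ∀ v : (Fin L × Fin m) ⊕ (Fin L × Fin p) → ℝ,
      (∃ α : Fin (N - L + 1) → ℝ, (stackedHankel m p N L ud yd).mulVec α = v) ↔
      ∃ (u : ℕ → Fin m → ℝ) (y : ℕ → Fin p → ℝ),
        IsTrajectory n m p L A B C D u y ∧
        (∀ (k : Fin L) (a : Fin m), v (Sum.inl (k, a)) = u k a) ∧
        (∀ (k : Fin L) (b : Fin p), v (Sum.inr (k, b)) = y k b) := by
  obtain ⟨x, hx⟩ := hT
  have hstate : ∀ α : Fin (N - L + 1) → ℝ, ∀ k < L, combineShifts x α (k + 1) =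
      A *ᵥ combineShifts x α k + B *ᵥ combineShifts ud α k := fun α k hk =>
    combineShifts_eq_mulVec_add_mulVec (fun j hj => by
      rw [add_right_comm]; exact (hx _ (by omega)).1) α
  have hout : ∀ α : Fin (N - L + 1) → ℝ, ∀ k < L, combineShifts yd α k =
      C *ᵥ combineShifts x α k + D *ᵥ combineShifts ud α k := fun α k hk =>
    combineShifts_eq_mulVec_add_mulVec (fun j hj => (hx _ (by omega)).2) α
  have hrank := hPE.rank_stateInputHankel hLN hctrb fun k hk => (hx k hk).1
  refine ⟨?_, fun v => ⟨?_, ?_⟩⟩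
  · have hker : ∀ α, stackedHankel m p N L ud yd *ᵥ α = 0 ↔
        stateInputHankel N L x ud *ᵥ α = 0 := by
      refine fun α => ⟨fun h => ?_, fun h => ?_⟩
      · have hu : ∀ k < L, combineShifts ud α k = 0 := fun k hk => by
          ext a
          rw [← stackedHankel_mulVec_inl ud yd α ⟨k, hk⟩ a, h]
          rfl
        have hy : ∀ k < L, combineShifts yd α k = 0 := fun k hk => by
          ext b
          rw [← stackedHankel_mulVec_inr ud yd α ⟨k, hk⟩ b, h]
          rfl
        have h0 : combineShifts x α 0 = 0 := hobs.initial_eq_zero hL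
          (fun k hk => by rw [hstate α k hk, hu k hk, Matrix.mulVec_zero, add_zero])
          (fun k hk => by
            rw [← hy k hk, hout α k hk, hu k hk, Matrix.mulVec_zero, add_zero])
        ext (i | ⟨k, a⟩)
        · rw [stateInputHankel_mulVec_inl, h0]; rfl
        · rw [stateInputHankel_mulVec_inr, hu k k.2]; rfl
      · have h0 : combineShifts x α 0 = 0 := by
          ext i
          rw [← stateInputHankel_mulVec_inl x ud α i, h]
          rfl
        have hu : ∀ k < L, combineShifts ud α k = 0 := fun k hk => by
          ext a
          rw [← stateInputHankel_mulVec_inr x ud α ⟨k, hk⟩ a, h]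
          rfl
        have hzero := state_eq_of_initial_eq (x' := 0) (u' := 0) (hstate α) (by simp) h0 hu
        ext (⟨k, a⟩ | ⟨k, b⟩)
        · rw [stackedHankel_mulVec_inl, hu k k.2]; rfl
        · rw [stackedHankel_mulVec_inr, hout α k k.2, hu k k.2, hzero k k.2.le]
          simp
    rw [rank_eq_rank_of_ker_iff hker, hrank]
    simp [mul_comm, add_comm]
  · rintro ⟨α, rfl⟩
    exact ⟨combineShifts ud α, combineShifts yd α,
      ⟨combineShifts x α, fun k hk => ⟨hstate α k hk, hout α k hk⟩⟩,
      stackedHankel_mulVec_inl ud yd α, stackedHankel_mulVec_inr ud yd α⟩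
  · rintro ⟨u, y, ⟨z, hz⟩, hvu, hvy⟩
    obtain ⟨α, hα⟩ := mulVec_surjective_of_rank hrank
      (Sum.elim (z 0) fun ka : Fin L × Fin m => u ka.1 ka.2)
    have h0 : combineShifts x α 0 = z 0 := by
      ext i
      rw [← stateInputHankel_mulVec_inl x ud α i, hα]
      rfl
    have hu : ∀ k < L, combineShifts ud α k = u k := fun k hk => by
      ext a
      rw [← stateInputHankel_mulVec_inr x ud α ⟨k, hk⟩ a, hα]
      rfl
    have hxz := state_eq_of_initial_eq (hstate α) (fun k hk => (hz k hk).1) h0 hu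
    refine ⟨α, ?_⟩
    ext (⟨k, a⟩ | ⟨k, b⟩)
    · rw [stackedHankel_mulVec_inl, hvu, hu k k.2]
    · rw [stackedHankel_mulVec_inr, hvy, hout α k k.2, hu k k.2, hxz k k.2.le,
        (hz k k.2).2]
end
end

section
/- Suppose (A,C) is observable and {u_k, y_k}_{k=0}^{T-1} is an input-output sequence such that, for some t with 0 ≤ t and t + n ≤ T, both the initial segment {u_k, y_k}_{k=0}^{t+n-1} and the final segment {u_k, y_k}_{k=t}^{T-1} are trajectories of the LTI system (so the two segments overlap on n steps). Then the whole sequence {u_k, y_k}_{k=0}^{T-1} is a trajectory of the LTI system. -/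
open Matrix

noncomputable section

theorem Matrix.mulVec_injective_of_rank_eq {ι : Type*} {n : ℕ} {M : Matrix ι (Fin n) ℝ}
    (h : M.rank = n) : Function.Injective M.mulVec := by
  have hker := LinearMap.finrank_range_add_finrank_ker M.mulVecLin
  rw [← Matrix.rank, h, Module.finrank_fin_fun, Nat.add_eq_left,
    Submodule.finrank_eq_zero] at hker
  exact LinearMap.ker_eq_bot.mp hker

theorem Observable.eq_zero {n p : ℕ} {A : Matrix (Fin n) (Fin n) ℝ}
    {C : Matrix (Fin p) (Fin n) ℝ} (h : Observable n p A C) {v : Fin n → ℝ}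
    (hv : ∀ i < n, C *ᵥ (A ^ i *ᵥ v) = 0) : v = 0 := by
  apply Matrix.mulVec_injective_of_rank_eq h
  rw [Matrix.mulVec_zero]
  ext ⟨i, j⟩
  have := congrFun (hv i i.isLt) j
  rwa [Matrix.mulVec_mulVec] at this

/-- In an observable system, the input and output over `n` steps determine the initial state. -/
theorem Observable.initial_state_unique {n m p : ℕ} {A : Matrix (Fin n) (Fin n) ℝ}
    {B : Matrix (Fin n) (Fin m) ℝ} {C : Matrix (Fin p) (Fin n) ℝ}
    {D : Matrix (Fin p) (Fin m) ℝ} (hobs : Observable n p A C)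
    {u : ℕ → Fin m → ℝ} {y : ℕ → Fin p → ℝ} {x z : ℕ → Fin n → ℝ}
    (hx : ∀ k < n, x (k + 1) = A *ᵥ x k + B *ᵥ u k ∧ y k = C *ᵥ x k + D *ᵥ u k)
    (hz : ∀ k < n, z (k + 1) = A *ᵥ z k + B *ᵥ u k ∧ y k = C *ᵥ z k + D *ᵥ u k) :
    x 0 = z 0 := by
  have hdiff : ∀ k ≤ n, A ^ k *ᵥ (x 0 - z 0) = x k - z k := by
    intro k hk
    induction k with
    | zero => simp
    | succ k ih =>
      rw [pow_succ', ← Matrix.mulVec_mulVec, ih (by omega), (hx k hk).1, (hz k hk).1,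
        Matrix.mulVec_sub, add_sub_add_right_eq_sub]
  refine sub_eq_zero.mp (hobs.eq_zero fun k hk => ?_)
  rw [hdiff k hk.le, Matrix.mulVec_sub, sub_eq_zero]
  exact add_right_cancel ((hx k hk).2.symm.trans (hz k hk).2)

/-- If the initial segment `{u_k, y_k}_{k=0}^{t+n-1}` and the final segment
`{u_k, y_k}_{k=t}^{T-1}` of a sequence are both trajectories of an observable system
(overlapping on `n` steps), then the whole sequence is a trajectory. -/
theorem glue_trajectories (n m p T t : ℕ)
    (A : Matrix (Fin n) (Fin n) ℝ) (B : Matrix (Fin n) (Fin m) ℝ)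
    (C : Matrix (Fin p) (Fin n) ℝ) (D : Matrix (Fin p) (Fin m) ℝ)
    (hobs : Observable n p A C)
    (u : ℕ → Fin m → ℝ) (y : ℕ → Fin p → ℝ)
    (ht : t + n ≤ T)
    (hinit : IsTrajectory n m p (t + n) A B C D u y)
    (hfinal : IsTrajectory n m p (T - t) A B C D
      (fun k => u (t + k)) (fun k => y (t + k))) :
    IsTrajectory n m p T A B C D u y := by
  obtain ⟨x, hx⟩ := hinit
  obtain ⟨z, hz⟩ := hfinal
  have hmatch : x t = z 0 :=
    hobs.initial_state_unique (x := fun k => x (t + k))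
      (fun k hk => hx (t + k) (by omega)) (fun k hk => hz k (by omega))
  refine ⟨fun k => if k < t then x k else z (k - t), fun k hk => ?_⟩
  rcases lt_or_ge k t with hkt | hkt
  · have hstep : (if k + 1 < t then x (k + 1) else z (k + 1 - t)) = x (k + 1) := by
      split_ifs with h
      · rfl
      · obtain rfl : t = k + 1 := by omega
        rw [hmatch, Nat.sub_self]
    simpa only [hstep, if_pos hkt] using hx k (by omega)
  · obtain ⟨j, rfl⟩ := Nat.exists_eq_add_of_le hkt
    have h₁ : ¬ t + j + 1 < t := by omega
    have h₂ : t + j + 1 - t = j + 1 := by omega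
    simpa only [if_neg h₁, if_neg hkt.not_gt, h₂, Nat.add_sub_cancel_left]
      using hz j (by omega)
end
end
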